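/- arXiv:math/0102103 — 7 statements merged into one kernel-verified Lean document; each statement's English description precedes it below -/
import Mathlib

section
/- Let A be an m×m matrix over ℚ with S = A − Aᵀ invertible and let ρ be an m×1 column vector over ℚ. Let B₁ be the (m+2)×(m+2) matrix with block form [[A, ρ, 0],[ρᵀ, 0, 1],[0, 0, 0]] and B₂ the (m+2)×(m+2) matrix [[A, ρ, 0],[ρᵀ, 0, 0],[0, 1, 0]] (blocks of sizes m,1,1). Then B₁ − B₁ᵀ and B₂ − B₂ᵀ are invertible, Z_{B₁} = [[Z_A, 0, −ρ],[ρᵀS⁻¹, 1, 0],[0, 0, 0]], and Z_{B₂} = [[Z_A, 0, ρ],[ρᵀS⁻¹, 0, 0],[0, 0, 1]]. -/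
open Matrix

/-- the effect of the two stabilization moves on `Z_A = A·S⁻¹`. -/
theorem stmt3 {m : ℕ} (A : Matrix (Fin m) (Fin m) ℚ) (ρ : Fin m → ℚ)
    (hA : IsUnit (A - Aᵀ).det) :
    -- the column block `[ρ, 0]` and the row block `[ρᵀ; 0]`
    let C : Matrix (Fin m) (Fin 2) ℚ := Matrix.of fun a b => if b = 0 then ρ a else 0
    let Rw : Matrix (Fin 2) (Fin m) ℚ := Matrix.of fun a b => if a = 0 then ρ b else 0
    let B₁ : Matrix (Fin m ⊕ Fin 2) (Fin m ⊕ Fin 2) ℚ :=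
      Matrix.fromBlocks A C Rw !![0, 1; 0, 0]
    let B₂ : Matrix (Fin m ⊕ Fin 2) (Fin m ⊕ Fin 2) ℚ :=
      Matrix.fromBlocks A C Rw !![0, 0; 1, 0]
    IsUnit (B₁ - B₁ᵀ).det ∧ IsUnit (B₂ - B₂ᵀ).det ∧
    B₁ * (B₁ - B₁ᵀ)⁻¹ =
      Matrix.fromBlocks (A * (A - Aᵀ)⁻¹)
        (Matrix.of fun a b => if b = 1 then -ρ a else 0)
        (Matrix.of fun a b => if a = 0 then (ρ ᵥ* (A - Aᵀ)⁻¹) b else 0)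
        !![1, 0; 0, 0] ∧
    B₂ * (B₂ - B₂ᵀ)⁻¹ =
      Matrix.fromBlocks (A * (A - Aᵀ)⁻¹)
        (Matrix.of fun a b => if b = 1 then ρ a else 0)
        (Matrix.of fun a b => if a = 0 then (ρ ᵥ* (A - Aᵀ)⁻¹) b else 0)
        !![0, 0; 0, 1] := by
  intro C Rw B₁ B₂
  have hCR : Cᵀ = Rw := by ext a b; simp [C, Rw]
  have hRC : Rwᵀ = C := by ext a b; simp [C, Rw]
  have h1 : B₁ - B₁ᵀ = Matrix.fromBlocks (A - Aᵀ) 0 0 !![0, 1; -1, 0] := by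
    simp only [B₁, Matrix.fromBlocks_transpose, hCR, hRC, sub_eq_add_neg, Matrix.fromBlocks_neg,
      Matrix.fromBlocks_add, add_neg_cancel]
    congr 1
    ext i j; fin_cases i <;> fin_cases j <;> simp
  have h2 : B₂ - B₂ᵀ = Matrix.fromBlocks (A - Aᵀ) 0 0 !![0, -1; 1, 0] := by
    simp only [B₂, Matrix.fromBlocks_transpose, hCR, hRC, sub_eq_add_neg, Matrix.fromBlocks_neg,
      Matrix.fromBlocks_add, add_neg_cancel]
    congr 1
    ext i j; fin_cases i <;> fin_cases j <;> simp
  have i1 : (B₁ - B₁ᵀ)⁻¹ = Matrix.fromBlocks (A - Aᵀ)⁻¹ 0 0 !![0, -1; 1, 0] := by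
    apply Matrix.inv_eq_right_inv
    rw [h1, Matrix.fromBlocks_multiply, Matrix.mul_nonsing_inv _ hA, ← Matrix.fromBlocks_one]
    congr 1 <;> simp [Matrix.one_fin_two]
  have i2 : (B₂ - B₂ᵀ)⁻¹ = Matrix.fromBlocks (A - Aᵀ)⁻¹ 0 0 !![0, 1; -1, 0] := by
    apply Matrix.inv_eq_right_inv
    rw [h2, Matrix.fromBlocks_multiply, Matrix.mul_nonsing_inv _ hA, ← Matrix.fromBlocks_one]
    congr 1 <;> simp [Matrix.one_fin_two]
  have hR : Rw * (A - Aᵀ)⁻¹ =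
      Matrix.of fun a b => if a = 0 then (ρ ᵥ* (A - Aᵀ)⁻¹) b else 0 := by
    ext a b
    fin_cases a <;> simp [Rw, Matrix.mul_apply, Matrix.vecMul, dotProduct]
  refine ⟨?_, ?_, ?_, ?_⟩
  · rw [h1, Matrix.det_fromBlocks_zero₂₁]
    simpa [Matrix.det_fin_two] using hA
  · rw [h2, Matrix.det_fromBlocks_zero₂₁]
    simpa [Matrix.det_fin_two] using hA
  · rw [i1, Matrix.fromBlocks_multiply, hR]
    congr 1
    · simp
    · ext a b; fin_cases b <;> simp [C, Matrix.mul_apply, Fin.sum_univ_two]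
    · simp
    · ext a b; fin_cases a <;> fin_cases b <;> simp
  · rw [i2, Matrix.fromBlocks_multiply, hR]
    congr 1
    · simp
    · ext a b; fin_cases b <;> simp [C, Matrix.mul_apply, Fin.sum_univ_two]
    · simp
    · ext a b; fin_cases a <;> fin_cases b <;> simp
end

section
/- Let D and D′ be diagonal m×m matrices with all entries in {0,1} such that for every i ∈ {1,…,n} the number of entries equal to 1 within the i-th block of D equals that of D′. Then for every noncommutative polynomial f in ℚ⟨x,z⟩ one has tr f(X,D) = tr f(X,D′). (Hence tr f(X, I_{1/2}) is independent of how the 0's and 1's of I_{1/2} are distributed within the blocks.) -/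
open Matrix

/-- Index type for `m × m` matrices partitioned into `n` blocks, the `i`-th of size `msize i`. -/
abbrev BlkIdx {n : ℕ} (msize : Fin n → ℕ) : Type := (i : Fin n) × Fin (msize i)

/-- The block-diagonal matrix `X` over the free algebra `F_n = ℚ⟨x_1,…,x_n⟩`,
whose `i`-th diagonal block is `x_i` times the identity. -/
noncomputable def Xblk {n : ℕ} (msize : Fin n → ℕ) :
    Matrix (BlkIdx msize) (BlkIdx msize) (FreeAlgebra ℚ (Fin n)) :=
  Matrix.diagonal fun p => FreeAlgebra.ι ℚ p.1

/-- `Z_A = A · (A − Aᵀ)⁻¹`. -/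
noncomputable def Zof {ι : Type*} [Fintype ι] [DecidableEq ι] (A : Matrix ι ι ℚ) :
    Matrix ι ι ℚ :=
  A * (A - Aᵀ)⁻¹

/-- Evaluation `f ↦ f(X, Z)` : the image of `f ∈ ℚ⟨x,z⟩` under the algebra homomorphism
`ℚ⟨x,z⟩ → M_m(F_n)`, `x ↦ X`, `z ↦ Z`. -/
noncomputable def evalf {n : ℕ} {ι : Type*} [Fintype ι] [DecidableEq ι]
    (X Z : Matrix ι ι (FreeAlgebra ℚ (Fin n))) (f : FreeAlgebra ℚ (Fin 2)) :
    Matrix ι ι (FreeAlgebra ℚ (Fin n)) :=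
  FreeAlgebra.lift ℚ ![X, Z] f

/-- A Seifert matrix of type `(msize 1, …, msize n)`: an integer matrix with blocks `A_{ij}`
satisfying `(A_{ij})ᵀ = A_{ji}` for `i ≠ j` and `det (A_{ii} − (A_{ii})ᵀ) = 1` for all `i`. -/
def IsSeifert {n : ℕ} (msize : Fin n → ℕ)
    (A : Matrix (BlkIdx msize) (BlkIdx msize) ℤ) : Prop :=
  (∀ (i j : Fin n), i ≠ j → ∀ (a : Fin (msize i)) (b : Fin (msize j)),
      A ⟨i, a⟩ ⟨j, b⟩ = A ⟨j, b⟩ ⟨i, a⟩) ∧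
  (∀ i : Fin n, (Matrix.of fun a b : Fin (msize i) =>
      A ⟨i, a⟩ ⟨i, b⟩ - A ⟨i, b⟩ ⟨i, a⟩).det = 1)

/-- A diagonal-entry function taking values in `{0,1}` with exactly half of the entries in
each block equal to `1` (the matrix `I_{1/2}`). -/
def IsHalfOnes {n : ℕ} (msize : Fin n → ℕ) (d : BlkIdx msize → ℚ) : Prop :=
  (∀ p, d p = 0 ∨ d p = 1) ∧
  (∀ i : Fin n,
    2 * (Finset.univ.filter fun a : Fin (msize i) => d ⟨i, a⟩ = 1).card = msize i)

/-- The reversal anti-automorphism of a free associative algebra, fixing each generator. -/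
noncomputable def rev {σ : Type*} (a : FreeAlgebra ℚ σ) : FreeAlgebra ℚ σ :=
  MulOpposite.unop
    (FreeAlgebra.lift ℚ (fun i => MulOpposite.op (FreeAlgebra.ι ℚ i)) a)

/-- View a rational matrix as a matrix over the free algebra `F_n`. -/
noncomputable def mapQ {n : ℕ} {ι κ : Type*} (Z : Matrix ι κ ℚ) :
    Matrix ι κ (FreeAlgebra ℚ (Fin n)) :=
  Z.map (algebraMap ℚ (FreeAlgebra ℚ (Fin n)))

theorem evalf_diag_aux {n : ℕ} (msize : Fin n → ℕ) (d : BlkIdx msize → ℚ)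
    (f : FreeAlgebra ℚ (Fin 2)) :
    evalf (Xblk msize) (mapQ (Matrix.diagonal d)) f =
      Matrix.diagonal fun p => FreeAlgebra.lift ℚ
        ![FreeAlgebra.ι ℚ p.1, algebraMap ℚ (FreeAlgebra ℚ (Fin n)) (d p)] f := by
  unfold evalf
  induction f using FreeAlgebra.induction with
  | grade0 r =>
    simp only [AlgHom.commutes]
    rfl
  | grade1 x =>
    fin_cases x
    · simp [Xblk]
    · simp [mapQ, Matrix.diagonal_map]
  | mul a b ha hb => simp only [map_mul, ha, hb, Matrix.diagonal_mul_diagonal]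
  | add a b ha hb => simp only [map_add, ha, hb, Matrix.diagonal_add]

theorem sum_block_aux {k : ℕ} {A : Type*} [AddCommMonoid A] (d : Fin k → ℚ)
    (hd : ∀ p, d p = 0 ∨ d p = 1) (g : ℚ → A) :
    ∑ a, g (d a) = (Finset.univ.filter fun a => d a = 1).card • g 1 +
      (k - (Finset.univ.filter fun a => d a = 1).card) • g 0 := by
  have h : ∀ a, g (d a) = if d a = 1 then g 1 else g 0 := by
    intro a
    rcases hd a with h | h <;> simp [h]
  have hc := Finset.card_filter_add_card_filter_not (s := Finset.univ) (fun a => d a = 1)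
  rw [Finset.card_univ, Fintype.card_fin] at hc
  simp only [h, Finset.sum_ite, Finset.sum_const]
  congr 2
  omega

/-- if diagonal 0-1 matrices `D`, `D′` have the same number of ones within
each block, then `tr f(X,D) = tr f(X,D′)` for every noncommutative polynomial `f`. -/
theorem stmt4 {n : ℕ} (hn : 1 ≤ n) (msize : Fin n → ℕ) (hpos : ∀ i, 0 < msize i)
    (d d' : BlkIdx msize → ℚ)
    (hd : ∀ p, d p = 0 ∨ d p = 1) (hd' : ∀ p, d' p = 0 ∨ d' p = 1)
    (hcount : ∀ i : Fin n,
      (Finset.univ.filter fun a : Fin (msize i) => d ⟨i, a⟩ = 1).card =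
      (Finset.univ.filter fun a : Fin (msize i) => d' ⟨i, a⟩ = 1).card)
    (f : FreeAlgebra ℚ (Fin 2)) :
    (evalf (Xblk msize) (mapQ (Matrix.diagonal d)) f).trace =
      (evalf (Xblk msize) (mapQ (Matrix.diagonal d')) f).trace := by
  rw [evalf_diag_aux, evalf_diag_aux, Matrix.trace_diagonal, Matrix.trace_diagonal,
    Fintype.sum_sigma, Fintype.sum_sigma]
  refine Finset.sum_congr rfl fun i _ => ?_
  have key := fun (e : BlkIdx msize → ℚ) (he : ∀ p, e p = 0 ∨ e p = 1) =>
    sum_block_aux (fun a : Fin (msize i) => e ⟨i, a⟩) (fun a => he ⟨i, a⟩)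
      (fun c => FreeAlgebra.lift ℚ
        ![FreeAlgebra.ι ℚ i, algebraMap ℚ (FreeAlgebra ℚ (Fin n)) c] f)
  refine (key d hd).trans (Eq.trans ?_ (key d' hd').symm)
  simp only [hcount i]
end

section
/- (S₁-invariance) Let A be a Seifert matrix of type (m_1,…,m_n) and let P be a block-diagonal integer matrix with diagonal blocks P_i of size m_i×m_i satisfying det P_i = ±1. Set B = P·A·Pᵀ (again a Seifert matrix of the same type). Then for every noncommutative polynomial f in ℚ⟨x,z⟩, tr f(X, Z_B) = tr f(X, Z_A); consequently χ_f(B) = χ_f(A). -/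
open Matrix

theorem s5_diff_block {n : ℕ} (msize : Fin n → ℕ)
    (A : Matrix (BlkIdx msize) (BlkIdx msize) ℤ) :
    IsSeifert msize A ↔ ∃ V : (i : Fin n) → Matrix (Fin (msize i)) (Fin (msize i)) ℤ,
      A - Aᵀ = Matrix.blockDiagonal' V ∧ ∀ i, (V i).det = 1 := by
  constructor
  · rintro ⟨h1, h2⟩
    refine ⟨fun i => Matrix.of fun a b => A ⟨i, a⟩ ⟨i, b⟩ - A ⟨i, b⟩ ⟨i, a⟩, ?_, h2⟩
    ext ⟨i, a⟩ ⟨j, b⟩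
    by_cases h : i = j
    · subst h
      simp [Matrix.blockDiagonal'_apply]
    · simp [Matrix.blockDiagonal'_apply, h, h1 i j h a b]
  · rintro ⟨V, h, hV⟩
    refine ⟨fun i j hij a b => ?_, fun i => ?_⟩
    · have := congrFun (congrFun h ⟨i, a⟩) ⟨j, b⟩
      simp [Matrix.blockDiagonal'_apply, hij] at this
      linarith
    · rw [← hV i]
      congr 1
      ext a b
      have := congrFun (congrFun h ⟨i, a⟩) ⟨i, b⟩
      simpa [Matrix.blockDiagonal'_apply] using this

theorem s5_mapQ_mul {n : ℕ} {ι : Type*} [Fintype ι] (M N : Matrix ι ι ℚ) :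
    (mapQ (M * N) : Matrix ι ι (FreeAlgebra ℚ (Fin n))) = mapQ M * mapQ N := by
  simp [mapQ, Matrix.map_mul]

theorem s5_mapQ_one {n : ℕ} {ι : Type*} [DecidableEq ι] :
    (mapQ (1 : Matrix ι ι ℚ) : Matrix ι ι (FreeAlgebra ℚ (Fin n))) = 1 := by
  simp [mapQ]

theorem s5_trace_comm {n : ℕ} {ι : Type*} [Fintype ι] (M : Matrix ι ι ℚ)
    (N : Matrix ι ι (FreeAlgebra ℚ (Fin n))) :
    (mapQ M * N).trace = (N * mapQ M).trace := by
  simp only [Matrix.trace, Matrix.diag, Matrix.mul_apply, mapQ, Matrix.map_apply]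
  rw [Finset.sum_comm]
  refine Finset.sum_congr rfl fun i _ => Finset.sum_congr rfl fun j _ => ?_
  exact Algebra.commutes _ _

theorem s5_evalf_conj {n : ℕ} {ι : Type*} [Fintype ι] [DecidableEq ι]
    (X Z Z' M : Matrix ι ι (FreeAlgebra ℚ (Fin n)))
    (hX : X * M = M * X) (hZ : Z' * M = M * Z) (f : FreeAlgebra ℚ (Fin 2)) :
    evalf X Z' f * M = M * evalf X Z f := by
  unfold evalf
  induction f using FreeAlgebra.induction with
  | grade0 r =>
    simp only [AlgHom.commutes]
    exact Algebra.commutes _ _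
  | grade1 i => fin_cases i <;> simpa
  | mul a b ha hb =>
    rw [map_mul, map_mul, mul_assoc, hb, ← mul_assoc, ha, mul_assoc]
  | add a b ha hb =>
    rw [map_add, map_add, add_mul, ha, hb, mul_add]

/-- S₁-invariance: congruence by a block-diagonal unimodular integer matrix
does not change `tr f(X, Z_A)`, hence not `χ_f`. -/
theorem stmt5 {n : ℕ} (hn : 1 ≤ n) (msize : Fin n → ℕ)
    (hpos : ∀ i, 0 < msize i) (heven : ∀ i, Even (msize i))
    (A : Matrix (BlkIdx msize) (BlkIdx msize) ℤ) (hA : IsSeifert msize A)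
    (P : Matrix (BlkIdx msize) (BlkIdx msize) ℤ)
    (hPblk : ∀ p q : BlkIdx msize, p.1 ≠ q.1 → P p q = 0)
    (hPdet : ∀ i : Fin n,
      (Matrix.of fun a b : Fin (msize i) => P ⟨i, a⟩ ⟨i, b⟩).det = 1 ∨
      (Matrix.of fun a b : Fin (msize i) => P ⟨i, a⟩ ⟨i, b⟩).det = -1) :
    IsSeifert msize (P * A * Pᵀ) ∧
    ∀ f : FreeAlgebra ℚ (Fin 2),
      (evalf (Xblk msize) (mapQ (Zof ((P * A * Pᵀ).map ((↑) : ℤ → ℚ)))) f).trace =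
        (evalf (Xblk msize) (mapQ (Zof (A.map ((↑) : ℤ → ℚ)))) f).trace ∧
      ∀ d : BlkIdx msize → ℚ, IsHalfOnes msize d →
        (evalf (Xblk msize) (mapQ (Zof ((P * A * Pᵀ).map ((↑) : ℤ → ℚ)))) f).trace -
          (evalf (Xblk msize) (mapQ (Matrix.diagonal d)) f).trace =
        (evalf (Xblk msize) (mapQ (Zof (A.map ((↑) : ℤ → ℚ)))) f).trace -
          (evalf (Xblk msize) (mapQ (Matrix.diagonal d)) f).trace := by
  obtain ⟨Q, hQ, hQdet⟩ : ∃ Q : (i : Fin n) → Matrix (Fin (msize i)) (Fin (msize i)) ℤ,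
      P = Matrix.blockDiagonal' Q ∧ ∀ i, (Q i).det = 1 ∨ (Q i).det = -1 := by
    refine ⟨fun i => Matrix.of fun a b => P ⟨i, a⟩ ⟨i, b⟩, ?_, hPdet⟩
    ext ⟨i, a⟩ ⟨j, b⟩
    by_cases h : i = j
    · subst h
      simp [Matrix.blockDiagonal'_apply]
    · simp [Matrix.blockDiagonal'_apply, h, hPblk ⟨i, a⟩ ⟨j, b⟩ h]
  refine ⟨?_, ?_⟩
  · rw [s5_diff_block] at hA ⊢
    obtain ⟨V, hV, hVdet⟩ := hA
    refine ⟨fun i => Q i * V i * (Q i)ᵀ, ?_, fun i => ?_⟩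
    · have : P * A * Pᵀ - (P * A * Pᵀ)ᵀ = P * (A - Aᵀ) * Pᵀ := by
        simp [Matrix.mul_sub, Matrix.sub_mul, Matrix.mul_assoc]
      rw [this, hV, hQ, Matrix.blockDiagonal'_transpose, Matrix.blockDiagonal'_mul,
        Matrix.blockDiagonal'_mul]
    · rw [Matrix.det_mul, Matrix.det_mul, Matrix.det_transpose, hVdet]
      rcases hQdet i with h | h <;> simp [h]
  · have hPu : IsUnit P.det := by
      have hPinv : P * Matrix.blockDiagonal' (fun i => (Q i)⁻¹) = 1 := by
        rw [hQ, ← Matrix.blockDiagonal'_mul, ← Matrix.blockDiagonal'_one]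
        congr 1
        funext i
        refine Matrix.mul_nonsing_inv _ ?_
        rcases hQdet i with h | h <;> simp [h]
      exact Matrix.isUnit_det_of_right_inverse hPinv
    set U : Matrix (BlkIdx msize) (BlkIdx msize) ℚ := P.map ((↑) : ℤ → ℚ) with hU
    set R : Matrix (BlkIdx msize) (BlkIdx msize) ℚ := A.map ((↑) : ℤ → ℚ) with hR
    have hUu : IsUnit U.det := by
      have : U.det = ((P.det : ℤ) : ℚ) := by
        rw [hU]
        exact ((Int.castRingHom ℚ).map_det P).symm
      rw [this]
      exact hPu.map (Int.castRingHom ℚ)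
    have hB : (P * A * Pᵀ).map ((↑) : ℤ → ℚ) = U * R * Uᵀ := by
      have h1 : (P * A * Pᵀ).map (Int.castRingHom ℚ) =
          P.map (Int.castRingHom ℚ) * A.map (Int.castRingHom ℚ) *
            (P.map (Int.castRingHom ℚ))ᵀ := by
        rw [Matrix.map_mul, Matrix.map_mul, Matrix.transpose_map]
      exact h1
    have hUt : IsUnit (Uᵀ).det := by rwa [Matrix.det_transpose]
    have hZ : Zof (U * R * Uᵀ) = U * Zof R * U⁻¹ := by
      unfold Zof
      have : U * R * Uᵀ - (U * R * Uᵀ)ᵀ = U * (R - Rᵀ) * Uᵀ := by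
        simp [Matrix.mul_sub, Matrix.sub_mul, Matrix.mul_assoc]
      rw [this, Matrix.mul_inv_rev, Matrix.mul_inv_rev]
      simp only [Matrix.mul_assoc]
      rw [Matrix.mul_nonsing_inv_cancel_left _ _ hUt]
    have hX : Xblk msize * mapQ U = mapQ U * Xblk msize := by
      ext p q
      simp only [Xblk, Matrix.diagonal_mul, Matrix.mul_diagonal, mapQ, Matrix.map_apply]
      by_cases h : p.1 = q.1
      · rw [h]
        exact (Algebra.commutes _ _).symm
      · simp [hU, hPblk p q h]
    have key : ∀ f : FreeAlgebra ℚ (Fin 2),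
        (evalf (Xblk msize) (mapQ (Zof ((P * A * Pᵀ).map ((↑) : ℤ → ℚ)))) f).trace =
        (evalf (Xblk msize) (mapQ (Zof R)) f).trace := by
      intro f
      rw [hB, hZ]
      have hc := s5_evalf_conj (Xblk msize) (mapQ (Zof R)) (mapQ (U * Zof R * U⁻¹)) (mapQ U) hX
        (by rw [← s5_mapQ_mul, ← s5_mapQ_mul, Matrix.nonsing_inv_mul_cancel_right _ _ hUu]) f
      have h1 : (mapQ U : Matrix _ _ (FreeAlgebra ℚ (Fin n))) * mapQ U⁻¹ = 1 := by
        rw [← s5_mapQ_mul, Matrix.mul_nonsing_inv _ hUu, s5_mapQ_one]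
      have h2 : (mapQ U⁻¹ : Matrix _ _ (FreeAlgebra ℚ (Fin n))) * mapQ U = 1 := by
        rw [← s5_mapQ_mul, Matrix.nonsing_inv_mul _ hUu, s5_mapQ_one]
      rw [← Matrix.mul_one (evalf (Xblk msize) (mapQ (U * Zof R * U⁻¹)) f), ← h1,
        ← Matrix.mul_assoc, hc, ← s5_trace_comm, ← Matrix.mul_assoc, h2, Matrix.one_mul]
    exact fun f => ⟨key f, fun d _ => by rw [key f]⟩
end

section
/- (S₂-invariance) Let A be a Seifert matrix of type (m_1,…,m_n), fix a component index i, and let ρ be an integer column vector of length m. Let B be either of the (m+2)×(m+2) stabilizations [[A, ρ, 0],[ρᵀ, 0, 1],[0, 0, 0]] or [[A, ρ, 0],[ρᵀ, 0, 0],[0, 1, 0]], where the two new indices are assigned to the i-th block (so B is a Seifert matrix of type (m_1,…,m_i+2,…,m_n), with corresponding block-diagonal generator matrix X_B having x_i in the two new diagonal positions). Then for every noncommutative polynomial f in ℚ⟨x,z⟩, χ_f(B) = χ_f(A), i.e. tr f(X_B, Z_B) − tr f(X_B, D_B) = tr f(X, Z_A) − tr f(X, D_A), where D_A, D_B are diagonal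 0-1 matrices having exactly half of the diagonal entries within each block equal to 1. -/
open Matrix

/-- The block of an index of the stabilized matrix: the two new indices are assigned to
the block `i₀`. -/
def blockOfStab {n : ℕ} {msize : Fin n → ℕ} (i₀ : Fin n) :
    BlkIdx msize ⊕ Fin 2 → Fin n :=
  Sum.elim Sigma.fst fun _ => i₀

/-- The block-diagonal generator matrix `X_B` for the stabilized index set. -/
noncomputable def XblkStab {n : ℕ} (msize : Fin n → ℕ) (i₀ : Fin n) :
    Matrix (BlkIdx msize ⊕ Fin 2) (BlkIdx msize ⊕ Fin 2) (FreeAlgebra ℚ (Fin n)) :=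
  Matrix.diagonal fun q => FreeAlgebra.ι ℚ (blockOfStab i₀ q)

/-- Diagonal 0-1 matrix on the stabilized index set having exactly half of the diagonal
entries within each block equal to 1 (block `i₀` now has size `msize i₀ + 2`). -/
def IsHalfOnesStab {n : ℕ} (msize : Fin n → ℕ) (i₀ : Fin n)
    (d : BlkIdx msize ⊕ Fin 2 → ℚ) : Prop :=
  (∀ q, d q = 0 ∨ d q = 1) ∧
  (∀ i : Fin n,
    2 * (Finset.univ.filter
        fun q : BlkIdx msize ⊕ Fin 2 => blockOfStab i₀ q = i ∧ d q = 1).card =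
      msize i + if i = i₀ then 2 else 0)


section helpers
variable {n : ℕ}

/-- Scalar evaluation. -/
noncomputable def scalF (f : FreeAlgebra ℚ (Fin 2)) (i : Fin n) (c : ℚ) :
    FreeAlgebra ℚ (Fin n) :=
  FreeAlgebra.lift ℚ ![FreeAlgebra.ι ℚ i, algebraMap ℚ _ c] f

theorem evalf_diag {κ : Type*} [Fintype κ] [DecidableEq κ] (b : κ → Fin n) (d : κ → ℚ)
    (f : FreeAlgebra ℚ (Fin 2)) :
    evalf (Matrix.diagonal fun q => FreeAlgebra.ι ℚ (b q)) (mapQ (Matrix.diagonal d)) f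
      = Matrix.diagonal fun q => scalF f (b q) (d q) := by
  have hm : (mapQ (Matrix.diagonal d) : Matrix κ κ (FreeAlgebra ℚ (Fin n)))
      = Matrix.diagonal fun q => algebraMap ℚ _ (d q) := by
    unfold mapQ
    rw [Matrix.diagonal_map (map_zero _)]
  rw [hm]
  unfold evalf scalF
  induction f using FreeAlgebra.induction with
  | grade0 r =>
    simp only [AlgHom.commutes]
    rw [Matrix.algebraMap_eq_diagonal]
    rfl
  | grade1 x =>
    fin_cases x <;> simp
  | mul a c ha hc => simp only [map_mul, ha, hc, Matrix.diagonal_mul_diagonal]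
  | add a c ha hc => simp only [map_add, ha, hc, Matrix.diagonal_add]

theorem two_sum {κ V : Type*} [Fintype κ] [DecidableEq κ] [AddCommGroup V]
    (b : κ → Fin n) (d : κ → ℚ) (hd : ∀ q, d q = 0 ∨ d q = 1)
    (hc : ∀ i, 2 * (Finset.univ.filter fun q => b q = i ∧ d q = 1).card
      = (Finset.univ.filter fun q => b q = i).card) (φ : Fin n → ℚ → V) :
    2 • ∑ q, φ (b q) (d q) = ∑ q, (φ (b q) 1 + φ (b q) 0) := by
  rw [← Finset.sum_fiberwise Finset.univ b, ← Finset.sum_fiberwise Finset.univ b (fun q => φ (b q) 1 + φ (b q) 0),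
    Finset.smul_sum]
  refine Finset.sum_congr rfl fun i _ => ?_
  have h1 : ∑ q with b q = i, (φ (b q) 1 + φ (b q) 0)
      = (Finset.univ.filter fun q => b q = i).card • (φ i 1 + φ i 0) := by
    rw [← Finset.sum_const]
    refine Finset.sum_congr rfl fun q hq => ?_
    rw [(Finset.mem_filter.1 hq).2]
  have hsplit := Finset.card_filter_add_card_filter_not (s := Finset.univ.filter fun q => b q = i)
    (fun q => d q = 1)
  have h2 : ∑ q with b q = i, φ (b q) (d q)
      = (Finset.univ.filter fun q => b q = i ∧ d q = 1).card • φ i 1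
        + (Finset.univ.filter fun q => b q = i ∧ ¬ d q = 1).card • φ i 0 := by
    rw [← Finset.sum_filter_add_sum_filter_not _ (fun q => d q = 1), Finset.filter_filter,
      Finset.filter_filter, ← Finset.sum_const, ← Finset.sum_const]
    congr 1
    · refine Finset.sum_congr rfl fun q hq => ?_
      obtain ⟨h, h'⟩ := (Finset.mem_filter.1 hq).2
      rw [h, h']
    · refine Finset.sum_congr rfl fun q hq => ?_
      obtain ⟨h, h'⟩ := (Finset.mem_filter.1 hq).2
      rw [h, (hd q).resolve_right h']
  rw [Finset.filter_filter, Finset.filter_filter] at hsplit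
  rw [h1, h2]
  have := hc i
  have e : (Finset.univ.filter fun q => b q = i ∧ ¬ d q = 1).card
      = (Finset.univ.filter fun q => b q = i ∧ d q = 1).card := by omega
  rw [e, ← this, ← smul_add, mul_smul]

/-- Triangular shape. -/
structure Tri {κ R : Type*} [Zero R] (M : Matrix (κ ⊕ Fin 2) (κ ⊕ Fin 2) R)
    (N : Matrix κ κ R) (u v : R) : Prop where
  a : ∀ p q, M (Sum.inl p) (Sum.inl q) = N p q
  u : M (Sum.inr 0) (Sum.inr 0) = u
  v : M (Sum.inr 1) (Sum.inr 1) = v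
  z1 : ∀ p, M (Sum.inl p) (Sum.inr 0) = 0
  z2 : ∀ p, M (Sum.inr 1) (Sum.inl p) = 0
  z3 : M (Sum.inr 1) (Sum.inr 0) = 0

theorem Tri.mul {κ R : Type*} [Fintype κ] [Ring R] {M M' : Matrix (κ ⊕ Fin 2) (κ ⊕ Fin 2) R}
    {N N' : Matrix κ κ R} {u v u' v' : R} (h : Tri M N u v) (h' : Tri M' N' u' v') :
    Tri (M * M') (N * N') (u * u') (v * v') := by
  constructor <;> intros <;>
    simp [Matrix.mul_apply, Fintype.sum_sum_type, Fin.sum_univ_two, h.a, h.u, h.v, h.z1, h.z2, h.z3,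
      h'.a, h'.u, h'.v, h'.z1, h'.z2, h'.z3]

theorem Tri.add {κ R : Type*} [Ring R] {M M' : Matrix (κ ⊕ Fin 2) (κ ⊕ Fin 2) R}
    {N N' : Matrix κ κ R} {u v u' v' : R} (h : Tri M N u v) (h' : Tri M' N' u' v') :
    Tri (M + M') (N + N') (u + u') (v + v') := by
  constructor <;> intros <;>
    simp [h.a, h.u, h.v, h.z1, h.z2, h.z3,
      h'.a, h'.u, h'.v, h'.z1, h'.z2, h'.z3]

theorem Tri.diag {κ R : Type*} [DecidableEq κ] [Ring R] (e : κ ⊕ Fin 2 → R) :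
    Tri (Matrix.diagonal e) (Matrix.diagonal fun p => e (Sum.inl p)) (e (Sum.inr 0))
      (e (Sum.inr 1)) := by
  constructor <;> intros <;> simp [Matrix.diagonal_apply]

theorem Tri.evalf {κ : Type*} [Fintype κ] [DecidableEq κ]
    {X Z : Matrix (κ ⊕ Fin 2) (κ ⊕ Fin 2) (FreeAlgebra ℚ (Fin n))}
    {X' Z' : Matrix κ κ (FreeAlgebra ℚ (Fin n))} {i : Fin n} {c c' : ℚ}
    (hX : Tri X X' (FreeAlgebra.ι ℚ i) (FreeAlgebra.ι ℚ i))
    (hZ : Tri Z Z' (algebraMap ℚ _ c) (algebraMap ℚ _ c')) (f : FreeAlgebra ℚ (Fin 2)) :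
    Tri (_root_.evalf X Z f) (_root_.evalf X' Z' f) (scalF f i c) (scalF f i c') := by
  unfold _root_.evalf scalF
  induction f using FreeAlgebra.induction with
  | grade0 r =>
    simp only [AlgHom.commutes]
    rw [Matrix.algebraMap_eq_diagonal, Matrix.algebraMap_eq_diagonal]
    exact Tri.diag _
  | grade1 x =>
    fin_cases x
    · simpa using hX
    · simpa using hZ
  | mul a c ha hc => simp only [map_mul]; exact ha.mul hc
  | add a c ha hc => simp only [map_add]; exact ha.add hc

theorem Tri.trace {κ R : Type*} [Fintype κ] [Ring R] {M : Matrix (κ ⊕ Fin 2) (κ ⊕ Fin 2) R}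
    {N : Matrix κ κ R} {u v : R} (h : Tri M N u v) : M.trace = N.trace + (u + v) := by
  simp [Matrix.trace, Fintype.sum_sum_type, Fin.sum_univ_two, h.a, h.u, h.v]

theorem Tri.mapQ {κ : Type*} {M : Matrix (κ ⊕ Fin 2) (κ ⊕ Fin 2) ℚ}
    {N : Matrix κ κ ℚ} {u v : ℚ} (h : Tri M N u v) :
    Tri (_root_.mapQ M : Matrix _ _ (FreeAlgebra ℚ (Fin n))) (_root_.mapQ N)
      (algebraMap ℚ _ u) (algebraMap ℚ _ v) := by
  constructor <;> intros <;> simp [_root_.mapQ, h.a, h.u, h.v, h.z1, h.z2, h.z3]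

theorem seifert_unit (msize : Fin n → ℕ)
    (A : Matrix (BlkIdx msize) (BlkIdx msize) ℤ) (hA : IsSeifert msize A) :
    IsUnit (A.map ((↑) : ℤ → ℚ) - (A.map ((↑) : ℤ → ℚ))ᵀ).det := by
  have h : A - Aᵀ = Matrix.blockDiagonal' fun i => (Matrix.of fun a b : Fin (msize i) =>
      A ⟨i, a⟩ ⟨i, b⟩ - A ⟨i, b⟩ ⟨i, a⟩) := by
    ext ⟨i, a⟩ ⟨j, b⟩
    by_cases hij : i = j
    · subst hij
      simp [Matrix.blockDiagonal'_apply_eq]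
    · rw [Matrix.blockDiagonal'_apply_ne _ _ _ hij]
      simp [hA.1 i j hij a b]
  have hdet : IsUnit (A - Aᵀ).det := by
    rw [h]
    apply Matrix.isUnit_det_of_right_inverse (B := Matrix.blockDiagonal' fun i =>
      (Matrix.of fun a b : Fin (msize i) => A ⟨i, a⟩ ⟨i, b⟩ - A ⟨i, b⟩ ⟨i, a⟩)⁻¹)
    rw [← Matrix.blockDiagonal'_mul, ← Matrix.blockDiagonal'_one]
    congr 1
    funext i
    exact Matrix.mul_nonsing_inv _ (by rw [hA.2 i]; exact isUnit_one)
  have e : A.map ((↑) : ℤ → ℚ) - (A.map ((↑) : ℤ → ℚ))ᵀ = (Int.castRingHom ℚ).mapMatrix (A - Aᵀ) := by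
    ext p q; simp
  rw [e, ← RingHom.map_det]
  exact hdet.map _

theorem Zof_stab {κ : Type*} [Fintype κ] [DecidableEq κ] (A : Matrix κ κ ℚ)
    (hA : IsUnit (A - Aᵀ).det) (ρ : κ → ℚ) (s t : ℚ) (hst : s - t ≠ 0) :
    Zof (Matrix.fromBlocks A
            (Matrix.of fun a b => if b = 0 then ρ a else 0)
            (Matrix.of fun a b => if a = 0 then ρ b else 0) !![0, s; t, 0])
     = Matrix.fromBlocks (Zof A) (Matrix.of fun a b => if b = 0 then 0 else - ρ a / (s - t))
        ((Matrix.of fun (a : Fin 2) b => if a = 0 then ρ b else 0) * (A - Aᵀ)⁻¹)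
        !![s / (s - t), 0; 0, - t / (s - t)] := by
  unfold Zof
  set R : Matrix κ (Fin 2) ℚ := Matrix.of fun a b => if b = 0 then ρ a else 0
  set R' : Matrix (Fin 2) κ ℚ := Matrix.of fun a b => if a = 0 then ρ b else 0
  have hR : Rᵀ = R' := by ext a b; simp [R, R']
  have hR' : R'ᵀ = R := by ext a b; simp [R, R']
  have hinv : (Matrix.fromBlocks A R R' !![0, s; t, 0] - (Matrix.fromBlocks A R R' !![0, s; t, 0])ᵀ)⁻¹
      = Matrix.fromBlocks (A - Aᵀ)⁻¹ 0 0 !![0, -1 / (s - t); 1 / (s-t), 0] := by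
    apply Matrix.inv_eq_right_inv
    have : Matrix.fromBlocks A R R' !![0, s; t, 0] - (Matrix.fromBlocks A R R' !![0, s; t, 0])ᵀ
       = Matrix.fromBlocks (A - Aᵀ) 0 0 !![0, s - t; t - s, 0] := by
      rw [Matrix.fromBlocks_transpose, hR, hR', sub_eq_add_neg, Matrix.fromBlocks_neg,
        Matrix.fromBlocks_add, sub_eq_add_neg]
      congr 1
      · simp
      · simp
      · ext a b; fin_cases a <;> fin_cases b <;> simp [sub_eq_add_neg]
    rw [this, Matrix.fromBlocks_multiply, Matrix.mul_nonsing_inv _ hA]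
    rw [← Matrix.fromBlocks_one]
    congr 1
    · simp
    · simp
    · simp
    · ext a b; fin_cases a <;> fin_cases b <;> simp [Matrix.mul_apply, Fin.sum_univ_two] <;> field_simp
      ring
  rw [hinv, Matrix.fromBlocks_multiply]
  congr 1
  · simp
  · ext a b; fin_cases b <;> simp [R, Matrix.mul_apply, Fin.sum_univ_two]
    ring
  · simp
  · ext a b; fin_cases a <;> fin_cases b <;> simp [R', Matrix.mul_apply, Fin.sum_univ_two] <;> ring

end helpers

/-- S₂-invariance: stabilization does not change `χ_f`. -/
theorem stmt6 {n : ℕ} (hn : 1 ≤ n) (msize : Fin n → ℕ)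
    (hpos : ∀ i, 0 < msize i) (heven : ∀ i, Even (msize i))
    (A : Matrix (BlkIdx msize) (BlkIdx msize) ℤ) (hA : IsSeifert msize A)
    (i₀ : Fin n) (ρ : BlkIdx msize → ℤ)
    (B : Matrix (BlkIdx msize ⊕ Fin 2) (BlkIdx msize ⊕ Fin 2) ℤ)
    (hB : B = Matrix.fromBlocks A
            (Matrix.of fun a b => if b = 0 then ρ a else 0)
            (Matrix.of fun a b => if a = 0 then ρ b else 0) !![0, 1; 0, 0] ∨
          B = Matrix.fromBlocks A
            (Matrix.of fun a b => if b = 0 then ρ a else 0)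
            (Matrix.of fun a b => if a = 0 then ρ b else 0) !![0, 0; 1, 0]) :
    ∀ f : FreeAlgebra ℚ (Fin 2),
      ∀ dA : BlkIdx msize → ℚ, IsHalfOnes msize dA →
      ∀ dB : BlkIdx msize ⊕ Fin 2 → ℚ, IsHalfOnesStab msize i₀ dB →
      (evalf (XblkStab msize i₀) (mapQ (Zof (B.map ((↑) : ℤ → ℚ)))) f).trace -
        (evalf (XblkStab msize i₀) (mapQ (Matrix.diagonal dB)) f).trace =
      (evalf (Xblk msize) (mapQ (Zof (A.map ((↑) : ℤ → ℚ)))) f).trace -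
        (evalf (Xblk msize) (mapQ (Matrix.diagonal dA)) f).trace := by
  intro f dA hdA dB hdB
  have hu := seifert_unit msize A hA
  have key : (evalf (XblkStab msize i₀) (mapQ (Zof (B.map ((↑) : ℤ → ℚ)))) f).trace
      = (evalf (Xblk msize) (mapQ (Zof (A.map ((↑) : ℤ → ℚ)))) f).trace
        + (scalF f i₀ 1 + scalF f i₀ 0) := by
    have hX : Tri (XblkStab msize i₀) (Xblk msize) (FreeAlgebra.ι ℚ i₀) (FreeAlgebra.ι ℚ i₀) :=
      Tri.diag _
    rcases hB with hB | hB
    · have e : B.map ((↑) : ℤ → ℚ) = Matrix.fromBlocks (A.map ((↑) : ℤ → ℚ))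
            (Matrix.of fun a b => if b = 0 then (ρ a : ℚ) else 0)
            (Matrix.of fun a b => if a = 0 then (ρ b : ℚ) else 0) !![0, 1; 0, 0] := by
        rw [hB, Matrix.fromBlocks_map]
        congr 1
        · ext a b; simp
        · ext a b; simp
        · ext a b; fin_cases a <;> fin_cases b <;> simp
      have hZ : Tri (Zof (B.map ((↑) : ℤ → ℚ))) (Zof (A.map ((↑) : ℤ → ℚ))) 1 0 := by
        rw [e, Zof_stab _ hu _ _ _ (by norm_num)]
        constructor <;> intros <;> simp [Matrix.mul_apply]
      exact (Tri.evalf hX hZ.mapQ f).trace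
    · have e : B.map ((↑) : ℤ → ℚ) = Matrix.fromBlocks (A.map ((↑) : ℤ → ℚ))
            (Matrix.of fun a b => if b = 0 then (ρ a : ℚ) else 0)
            (Matrix.of fun a b => if a = 0 then (ρ b : ℚ) else 0) !![0, 0; 1, 0] := by
        rw [hB, Matrix.fromBlocks_map]
        congr 1
        · ext a b; simp
        · ext a b; simp
        · ext a b; fin_cases a <;> fin_cases b <;> simp
      have hZ : Tri (Zof (B.map ((↑) : ℤ → ℚ))) (Zof (A.map ((↑) : ℤ → ℚ))) 0 1 := by
        rw [e, Zof_stab _ hu _ _ _ (by norm_num)]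
        constructor <;> intros <;> simp [Matrix.mul_apply]
      rw [(Tri.evalf hX hZ.mapQ f).trace, add_comm (scalF f i₀ 0)]
  have hcardA : ∀ i, (Finset.univ.filter fun p : BlkIdx msize => p.1 = i).card = msize i := by
    intro i
    rw [Finset.card_filter, Fintype.sum_sigma, Finset.sum_eq_single i]
    · simp
    · intro j _ hj
      simp [hj]
    · simp
  have hcardA' : ∀ i, (Finset.univ.filter fun p : BlkIdx msize => p.1 = i ∧ dA p = 1).card
      = (Finset.univ.filter fun a : Fin (msize i) => dA ⟨i, a⟩ = 1).card := by
    intro i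
    rw [Finset.card_filter, Fintype.sum_sigma, Finset.card_filter, Finset.sum_eq_single i]
    · simp
    · intro j _ hj
      simp [hj]
    · simp
  have hcardB : ∀ i, (Finset.univ.filter fun q : BlkIdx msize ⊕ Fin 2 =>
      blockOfStab i₀ q = i).card = msize i + if i = i₀ then 2 else 0 := by
    intro i
    rw [Finset.card_filter, Fintype.sum_sum_type, ← hcardA i, Finset.card_filter]
    congr 1
    simp only [blockOfStab, Sum.elim_inr, Fin.sum_univ_two, eq_comm (a := i)]
    by_cases h : i₀ = i <;> simp [h]
  have tA := two_sum (fun p : BlkIdx msize => p.1) dA hdA.1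
    (fun i => by rw [hcardA, hcardA', hdA.2]) (scalF f)
  have tB := two_sum (blockOfStab (msize := msize) i₀) dB hdB.1
    (fun i => by rw [hcardB, hdB.2]) (scalF f)
  have fin : (evalf (XblkStab msize i₀) (mapQ (Matrix.diagonal dB)) f).trace
      = (evalf (Xblk msize) (mapQ (Matrix.diagonal dA)) f).trace
        + (scalF f i₀ 1 + scalF f i₀ 0) := by
    unfold XblkStab Xblk
    rw [evalf_diag, evalf_diag (fun p : BlkIdx msize => p.1), Matrix.trace_diagonal,
      Matrix.trace_diagonal]
    have h2 : (2 : ℚ) ≠ 0 := two_ne_zero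
    apply smul_right_injective _ h2
    have conv2 : ∀ w : FreeAlgebra ℚ (Fin n), (2 : ℚ) • w = 2 • w := fun w => by
      rw [two_smul, two_nsmul]
    simp only [conv2]
    rw [smul_add, tA, tB, Fintype.sum_sum_type, Fin.sum_univ_two, two_nsmul]
    rfl
  rw [key, fin]
  abel
end

section
/- (Duality) Let A be a Seifert matrix of type (m_1,…,m_n) and f a noncommutative polynomial in ℚ⟨x,z⟩. Let g ∈ ℚ⟨x,z⟩ be obtained from the reversal f̃ of f by substituting 1−z for z. Then rev(tr f(X, Z_A)) = tr f̃(X, I − Z_A), and consequently rev(χ_f(A)) = χ_g(A). -/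
open Matrix

/-- The substitution endomorphism of `ℚ⟨x,z⟩` sending `x ↦ x`, `z ↦ 1 − z`. -/
noncomputable def substOneSubZ : FreeAlgebra ℚ (Fin 2) →ₐ[ℚ] FreeAlgebra ℚ (Fin 2) :=
  FreeAlgebra.lift ℚ ![FreeAlgebra.ι ℚ 0, 1 - FreeAlgebra.ι ℚ 1]

section helpers

theorem rev_add' {σ : Type*} (a b : FreeAlgebra ℚ σ) : rev (a + b) = rev a + rev b := by
  simp [rev]

theorem rev_sub' {σ : Type*} (a b : FreeAlgebra ℚ σ) : rev (a - b) = rev a - rev b := by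
  simp [rev]

theorem rev_mul' {σ : Type*} (a b : FreeAlgebra ℚ σ) : rev (a * b) = rev b * rev a := by
  simp [rev]

theorem rev_zero' {σ : Type*} : rev (0 : FreeAlgebra ℚ σ) = 0 := by
  simp [rev]

theorem rev_algebraMap' {σ : Type*} (r : ℚ) :
    rev (algebraMap ℚ (FreeAlgebra ℚ σ) r) = algebraMap ℚ (FreeAlgebra ℚ σ) r := by
  simp only [rev, AlgHom.commutes, MulOpposite.algebraMap_apply, MulOpposite.unop_op]

theorem rev_iota' {σ : Type*} (i : σ) :
    rev (FreeAlgebra.ι ℚ i) = FreeAlgebra.ι ℚ i := by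
  simp [rev]

theorem rev_sum' {σ κ : Type*} (s : Finset κ) (g : κ → FreeAlgebra ℚ σ) :
    rev (∑ i ∈ s, g i) = ∑ i ∈ s, rev (g i) := by
  classical
  induction s using Finset.induction_on with
  | empty => simp [rev_zero']
  | insert a s ha ih => rw [Finset.sum_insert ha, Finset.sum_insert ha, rev_add', ih]

variable {n : ℕ} {ι : Type*} [Fintype ι] [DecidableEq ι]

/-- entrywise reversal of the transpose -/
noncomputable def tr' (M : Matrix ι ι (FreeAlgebra ℚ (Fin n))) :
    Matrix ι ι (FreeAlgebra ℚ (Fin n)) := Matrix.of fun i j => rev (M j i)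

theorem tr'_add (M N : Matrix ι ι (FreeAlgebra ℚ (Fin n))) : tr' (M + N) = tr' M + tr' N := by
  ext i j
  simp [tr', rev_add']

theorem tr'_mul (M N : Matrix ι ι (FreeAlgebra ℚ (Fin n))) : tr' (M * N) = tr' N * tr' M := by
  ext i j
  simp [tr', Matrix.mul_apply, rev_sum', rev_mul']

theorem tr'_algebraMap (r : ℚ) :
    tr' (algebraMap ℚ (Matrix ι ι (FreeAlgebra ℚ (Fin n))) r) = algebraMap ℚ _ r := by
  ext i j
  simp only [tr', Matrix.of_apply, Matrix.algebraMap_matrix_apply, eq_comm (a := j)]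
  split_ifs
  · exact rev_algebraMap' r
  · exact rev_zero'

theorem tr'_mapQ (Z : Matrix ι ι ℚ) : tr' (mapQ (n := n) Z) = mapQ Zᵀ := by
  ext i j
  simp [tr', mapQ, rev_algebraMap']

theorem trace_tr' (M : Matrix ι ι (FreeAlgebra ℚ (Fin n))) : (tr' M).trace = rev M.trace := by
  simp [Matrix.trace, tr', rev_sum']

theorem mapQ_mul (Z W : Matrix ι ι ℚ) : mapQ (n := n) (Z * W) = mapQ Z * mapQ W := by
  simp [mapQ, Matrix.map_mul]

theorem mapQ_one : mapQ (n := n) (1 : Matrix ι ι ℚ) = 1 := by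
  simp [mapQ]

theorem mapQ_sub (Z W : Matrix ι ι ℚ) : mapQ (n := n) (Z - W) = mapQ Z - mapQ W := by
  ext i j
  simp [mapQ]

theorem trace_mapQ_comm (M : Matrix ι ι (FreeAlgebra ℚ (Fin n))) (S : Matrix ι ι ℚ) :
    (mapQ S * M).trace = (M * mapQ S).trace := by
  simp only [Matrix.trace, Matrix.diag, Matrix.mul_apply, mapQ, Matrix.map_apply]
  rw [Finset.sum_comm]
  simp only [Algebra.commutes]

theorem evalf_rev (X : Matrix ι ι (FreeAlgebra ℚ (Fin n))) (Z W S : Matrix ι ι ℚ)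
    (hX : tr' X = X) (hSX : mapQ S * X = X * mapQ S) (hSZ : S * Zᵀ = W * S)
    (f : FreeAlgebra ℚ (Fin 2)) :
    mapQ S * tr' (evalf X (mapQ Z) f) = evalf X (mapQ W) (rev f) * mapQ S := by
  unfold evalf
  induction f using FreeAlgebra.induction with
  | grade0 r =>
    rw [rev_algebraMap', AlgHom.commutes, AlgHom.commutes, tr'_algebraMap]
    exact (Algebra.commutes r _).symm
  | grade1 i =>
    rw [rev_iota', FreeAlgebra.lift_ι_apply, FreeAlgebra.lift_ι_apply]
    fin_cases i
    · simpa [hX] using hSX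
    · simp [tr'_mapQ, ← mapQ_mul, hSZ]
  | mul a b ha hb =>
    rw [rev_mul', map_mul, map_mul, tr'_mul, ← mul_assoc, hb, mul_assoc, ha, mul_assoc]
  | add a b ha hb =>
    rw [rev_add', map_add, map_add, tr'_add, mul_add, ha, hb, add_mul]

theorem trace_evalf_rev (X : Matrix ι ι (FreeAlgebra ℚ (Fin n))) (Z W S T : Matrix ι ι ℚ)
    (hX : tr' X = X) (hSX : mapQ S * X = X * mapQ S) (hSZ : S * Zᵀ = W * S) (hST : S * T = 1)
    (f : FreeAlgebra ℚ (Fin 2)) :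
    rev (evalf X (mapQ Z) f).trace = (evalf X (mapQ W) (rev f)).trace := by
  have h := evalf_rev X Z W S hX hSX hSZ f
  have hTS : T * S = 1 := mul_eq_one_comm.mp hST
  rw [← trace_tr']
  calc (tr' (evalf X (mapQ Z) f)).trace
      = (mapQ T * (mapQ S * tr' (evalf X (mapQ Z) f))).trace := by
        rw [← mul_assoc, ← mapQ_mul, hTS, mapQ_one, one_mul]
    _ = _ := by
        rw [h, trace_mapQ_comm, mul_assoc, ← mapQ_mul, hST, mapQ_one, mul_one]

theorem evalf_subst (X Z : Matrix ι ι (FreeAlgebra ℚ (Fin n))) (f : FreeAlgebra ℚ (Fin 2)) :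
    evalf X Z (substOneSubZ f) = evalf X (1 - Z) f := by
  unfold evalf substOneSubZ
  rw [← AlgHom.comp_apply]
  congr 1
  ext i
  fin_cases i <;> simp

theorem tr'_Xblk (msize : Fin n → ℕ) : tr' (Xblk msize) = Xblk msize := by
  ext p q
  by_cases h : p = q
  · subst h
    simp [tr', Xblk, rev_iota']
  · simp [tr', Xblk, h, Ne.symm h, rev_zero', Matrix.diagonal_apply_ne _ (Ne.symm h)]

theorem Xblk_comm (msize : Fin n → ℕ) (S : Matrix (BlkIdx msize) (BlkIdx msize) ℚ)
    (hS : ∀ p q, p.1 ≠ q.1 → S p q = 0) : mapQ S * Xblk msize = Xblk msize * mapQ S := by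
  ext p q
  simp only [Xblk, Matrix.mul_diagonal, Matrix.diagonal_mul, mapQ, Matrix.map_apply]
  by_cases h : p.1 = q.1
  · rw [h, Algebra.commutes]
  · simp [hS p q h]

/-- scalar evaluation -/
noncomputable def sev (i : Fin n) (c : ℚ) : FreeAlgebra ℚ (Fin 2) →ₐ[ℚ] FreeAlgebra ℚ (Fin n) :=
  FreeAlgebra.lift ℚ ![FreeAlgebra.ι ℚ i, algebraMap ℚ _ c]

theorem evalf_diag_s8 (msize : Fin n → ℕ) (d : BlkIdx msize → ℚ) (f : FreeAlgebra ℚ (Fin 2)) :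
    evalf (Xblk msize) (mapQ (Matrix.diagonal d)) f =
      Matrix.diagonal fun p => sev p.1 (d p) f := by
  unfold evalf
  induction f using FreeAlgebra.induction with
  | grade0 r =>
    simp only [AlgHom.commutes]
    rfl
  | grade1 i =>
    fin_cases i
    · simp [sev, Xblk]
    · simp [sev, mapQ, Matrix.diagonal_map]
  | mul a b ha hb => simp [ha, hb]
  | add a b ha hb => simp [ha, hb]

theorem half_sum {k : ℕ} {R : Type*} [AddCommGroup R] (d : Fin k → ℚ) (h01 : ∀ a, d a = 0 ∨ d a = 1)
    (hc : 2 * (Finset.univ.filter fun a => d a = 1).card = k) (F : ℚ → R) :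
    ∑ a, F (d a) = ∑ a, F (1 - d a) := by
  have hadd := Finset.card_filter_add_card_filter_not (s := (Finset.univ : Finset (Fin k)))
    (fun a => d a = 1)
  rw [Finset.card_univ, Fintype.card_fin] at hadd
  have hcard : (Finset.univ.filter fun a => ¬ d a = 1).card =
      (Finset.univ.filter fun a => d a = 1).card := by omega
  rw [← Finset.sum_filter_add_sum_filter_not _ (fun a => d a = 1) (fun a => F (d a)),
    ← Finset.sum_filter_add_sum_filter_not _ (fun a => d a = 1) (fun a => F (1 - d a))]
  have key : ∀ (G : ℚ → R), (∑ a with d a = 1, G (d a) =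
        (Finset.univ.filter fun a => d a = 1).card • G 1) ∧
      (∑ a with ¬ d a = 1, G (d a) = (Finset.univ.filter fun a => d a = 1).card • G 0) := by
    intro G
    constructor
    · rw [Finset.sum_congr rfl (g := fun _ => G 1), Finset.sum_const]
      intro a ha
      rw [(Finset.mem_filter.mp ha).2]
    · rw [Finset.sum_congr rfl (g := fun _ => G 0), Finset.sum_const, hcard]
      intro a ha
      rw [(h01 a).resolve_right (Finset.mem_filter.mp ha).2]
  rw [(key F).1, (key F).2, (key fun x => F (1 - x)).1, (key fun x => F (1 - x)).2]
  simp [add_comm]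

theorem trace_diag_symm (msize : Fin n → ℕ) (d : BlkIdx msize → ℚ) (hd : IsHalfOnes msize d)
    (f : FreeAlgebra ℚ (Fin 2)) :
    (evalf (Xblk msize) (mapQ (Matrix.diagonal d)) f).trace =
      (evalf (Xblk msize) (mapQ (1 - Matrix.diagonal d)) f).trace := by
  have h1 : (1 : Matrix (BlkIdx msize) (BlkIdx msize) ℚ) - Matrix.diagonal d =
      Matrix.diagonal fun p => 1 - d p := by
    rw [← Matrix.diagonal_one, Matrix.diagonal_sub]
  rw [h1, evalf_diag_s8, evalf_diag_s8, Matrix.trace_diagonal, Matrix.trace_diagonal,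
    Fintype.sum_sigma, Fintype.sum_sigma]
  refine Finset.sum_congr rfl fun i _ => ?_
  exact half_sum (fun a => d ⟨i, a⟩) (fun a => hd.1 _) (hd.2 i) (fun c => sev i c f)

theorem seifert_det (msize : Fin n → ℕ) (A : Matrix (BlkIdx msize) (BlkIdx msize) ℤ)
    (hA : IsSeifert msize A) : IsUnit (A - Aᵀ).det := by
  have h : A - Aᵀ = Matrix.blockDiagonal' fun i => (Matrix.of fun a b : Fin (msize i) =>
      A ⟨i, a⟩ ⟨i, b⟩ - A ⟨i, b⟩ ⟨i, a⟩) := by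
    ext ⟨i, a⟩ ⟨j, b⟩
    by_cases hij : i = j
    · subst hij
      simp [Matrix.blockDiagonal'_apply]
    · rw [Matrix.blockDiagonal'_apply_ne _ _ _ hij]
      simp [hA.1 i j hij a b]
  rw [h]
  refine Matrix.isUnit_det_of_right_inverse (B := Matrix.blockDiagonal' fun i =>
    (Matrix.of fun a b : Fin (msize i) => A ⟨i, a⟩ ⟨i, b⟩ - A ⟨i, b⟩ ⟨i, a⟩)⁻¹) ?_
  rw [← Matrix.blockDiagonal'_mul, ← Matrix.blockDiagonal'_one]
  congr 1
  funext i
  exact Matrix.mul_nonsing_inv _ (by rw [hA.2 i]; exact isUnit_one)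

theorem seifert_trace (msize : Fin n → ℕ) (A : Matrix (BlkIdx msize) (BlkIdx msize) ℤ)
    (hA : IsSeifert msize A) (f : FreeAlgebra ℚ (Fin 2)) :
    rev ((evalf (Xblk msize) (mapQ (Zof (A.map ((↑) : ℤ → ℚ)))) f).trace) =
      (evalf (Xblk msize) (mapQ (1 - Zof (A.map ((↑) : ℤ → ℚ)))) (rev f)).trace := by
  set B : Matrix (BlkIdx msize) (BlkIdx msize) ℚ := A.map ((↑) : ℤ → ℚ) with hB
  have hmap : B - Bᵀ = (Int.castRingHom ℚ).mapMatrix (A - Aᵀ) := by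
    ext p q
    simp [hB]
  have hu : IsUnit (B - Bᵀ).det := by
    rw [hmap, ← RingHom.map_det]
    exact (seifert_det msize A hA).map _
  have hST : (B - Bᵀ) * (B - Bᵀ)⁻¹ = 1 := Matrix.mul_nonsing_inv _ hu
  have hTS : (B - Bᵀ)⁻¹ * (B - Bᵀ) = 1 := Matrix.nonsing_inv_mul _ hu
  refine trace_evalf_rev _ _ _ (B - Bᵀ) (B - Bᵀ)⁻¹ (tr'_Xblk msize) (Xblk_comm msize _ ?_) ?_ hST f
  · rintro ⟨i, a⟩ ⟨j, b⟩ hij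
    simp [hB, hA.1 i j hij a b]
  · have hneg : (B - Bᵀ)ᵀ = -(B - Bᵀ) := by simp
    have hT : ((B - Bᵀ)⁻¹)ᵀ = -(B - Bᵀ)⁻¹ := by
      rw [Matrix.transpose_nonsing_inv, hneg]
      apply Matrix.inv_eq_right_inv
      rw [neg_mul_neg, hST]
    unfold Zof
    rw [Matrix.transpose_mul, hT, sub_mul 1, mul_assoc B, hTS, neg_mul, mul_neg, ← mul_assoc, hST]
    simp

end helpers

/-- Duality: `rev (tr f(X, Z_A)) = tr f̃(X, I − Z_A)`; consequently
`rev (χ_f(A)) = χ_g(A)` where `g` is obtained from `f̃` by substituting `1 − z` for `z`. -/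
theorem stmt8 {n : ℕ} (hn : 1 ≤ n) (msize : Fin n → ℕ)
    (hpos : ∀ i, 0 < msize i) (heven : ∀ i, Even (msize i))
    (A : Matrix (BlkIdx msize) (BlkIdx msize) ℤ) (hA : IsSeifert msize A)
    (f : FreeAlgebra ℚ (Fin 2)) :
    rev ((evalf (Xblk msize) (mapQ (Zof (A.map ((↑) : ℤ → ℚ)))) f).trace) =
      (evalf (Xblk msize) (mapQ (1 - Zof (A.map ((↑) : ℤ → ℚ)))) (rev f)).trace ∧
    ∀ d : BlkIdx msize → ℚ, IsHalfOnes msize d →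
      rev ((evalf (Xblk msize) (mapQ (Zof (A.map ((↑) : ℤ → ℚ)))) f).trace -
          (evalf (Xblk msize) (mapQ (Matrix.diagonal d)) f).trace) =
        (evalf (Xblk msize) (mapQ (Zof (A.map ((↑) : ℤ → ℚ))))
            (substOneSubZ (rev f))).trace -
          (evalf (Xblk msize) (mapQ (Matrix.diagonal d)) (substOneSubZ (rev f))).trace := by
  have h1 := seifert_trace msize A hA f
  refine ⟨h1, fun d hd => ?_⟩
  have h2 : rev (evalf (Xblk msize) (mapQ (Matrix.diagonal d)) f).trace =
      (evalf (Xblk msize) (mapQ (Matrix.diagonal d)) (rev f)).trace :=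
    trace_evalf_rev _ _ _ 1 1 (tr'_Xblk msize) (by simp [mapQ_one]) (by simp) (by simp) f
  rw [rev_sub', h1, h2, trace_diag_symm msize d hd, evalf_subst, evalf_subst, mapQ_sub, mapQ_sub,
    mapQ_one]
end

section
/- (Trace formula) Let Z be an m×m matrix over ℚ with blocks Z_{ij} of size m_i×m_j, let k ≥ 1, e_1,…,e_k ≥ 1 and f_0,…,f_k ≥ 0 be integers. Then tr(X^{f_0} Z^{e_1} X^{f_1} ⋯ Z^{e_k} X^{f_k}) = Σ_{i_1,…,i_k ∈ {1,…,n}} tr((Z^{e_1})_{i_1 i_2} (Z^{e_2})_{i_2 i_3} ⋯ (Z^{e_k})_{i_k i_1}) · x_{i_1}^{f_0} x_{i_2}^{f_1} ⋯ x_{i_k}^{f_{k−1}} x_{i_1}^{f_k} in F_n, where (Z^e)_{ij} denotes the (i,j) block of Z^e. -/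
open Matrix

theorem path_expand {ι R : Type*} [Fintype ι] [DecidableEq ι] [Ring R] [Algebra ℚ R] (k : ℕ) :
    ∀ (A : Fin (k + 1) → Matrix ι ι ℚ) (D : Fin (k + 1) → ι → R) (p q : ι),
    (List.ofFn fun j : Fin (k + 1) =>
      (A j).map (algebraMap ℚ R) * Matrix.diagonal (D j)).prod p q =
    ∑ r : Fin k → ι,
      algebraMap ℚ R (∏ j : Fin (k + 1),
        A j (Fin.cons (α := fun _ => ι) p r j) (Fin.snoc (α := fun _ => ι) r q j)) *
      (List.ofFn fun j : Fin (k + 1) => D j (Fin.snoc (α := fun _ => ι) r q j)).prod := by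
  induction k with
  | zero =>
    intro A D p q
    simp [Fin.snoc, Matrix.mul_diagonal]
  | succ k ih =>
    intro A D p q
    rw [List.ofFn_succ, List.prod_cons, Matrix.mul_apply,
      ← (Fin.consEquiv (fun _ : Fin (k + 1) => ι)).sum_comp, Fintype.sum_prod_type]
    refine Finset.sum_congr rfl fun s _ => ?_
    rw [ih (fun j => A j.succ) (fun j => D j.succ) s q, Finset.mul_sum]
    refine Finset.sum_congr rfl fun r _ => ?_
    simp only [Fin.consEquiv, Equiv.coe_fn_mk]
    rw [Fin.prod_univ_succ (n := k + 1), List.ofFn_succ (n := k + 1), List.prod_cons, ← Fin.cons_snoc_eq_snoc_cons]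
    simp only [Fin.cons_zero, Fin.cons_succ, Matrix.mul_diagonal, Matrix.map_apply, map_mul]
    rw [mul_assoc, mul_assoc, ← mul_assoc (D 0 s), ← Algebra.commutes _ (D 0 s), mul_assoc]

theorem snoc_cyc {ι : Type*} (k : ℕ) (p : ι) (r : Fin k → ι) (j : Fin (k + 1)) :
    Fin.snoc (α := fun _ => ι) r p j = Fin.cons (α := fun _ => ι) p r (j + 1) := by
  refine Fin.lastCases ?_ (fun i => ?_) j
  · simp
  · rw [Fin.snoc_castSucc, Fin.coeSucc_eq_succ, Fin.cons_succ]

/-- Functions into a sigma type. -/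
def piSigEquiv {J I : Type*} (B : I → Type*) :
    ((i : J → I) × ((j : J) → B (i j))) ≃ (J → (i : I) × B i) where
  toFun x j := ⟨x.1 j, x.2 j⟩
  invFun c := ⟨fun j => (c j).1, fun j => (c j).2⟩
  left_inv _ := rfl
  right_inv _ := rfl

/-- Trace formula: `tr (X^{f₀} Z^{e₁} X^{f₁} ⋯ Z^{e_K} X^{f_K})`
(here `K = k+1 ≥ 1`) equals the sum over block indices `i₁,…,i_K` of
`tr ((Z^{e₁})_{i₁ i₂} ⋯ (Z^{e_K})_{i_K i₁}) · x_{i₁}^{f₀} x_{i₂}^{f₁} ⋯ x_{i_K}^{f_{K-1}} x_{i₁}^{f_K}`. -/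
theorem stmt11 {n : ℕ} (hn : 1 ≤ n) (msize : Fin n → ℕ) (hpos : ∀ i, 0 < msize i)
    (Z : Matrix (BlkIdx msize) (BlkIdx msize) ℚ)
    (k : ℕ) (e : Fin (k + 1) → ℕ) (he : ∀ j, 1 ≤ e j) (fexp : Fin (k + 2) → ℕ) :
    (Xblk msize ^ fexp 0 *
        (List.ofFn fun j : Fin (k + 1) =>
          (mapQ Z : Matrix (BlkIdx msize) (BlkIdx msize) (FreeAlgebra ℚ (Fin n))) ^ e j *
            Xblk msize ^ fexp j.succ).prod).trace =
      ∑ i : Fin (k + 1) → Fin n,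
        algebraMap ℚ (FreeAlgebra ℚ (Fin n))
            (∑ a : (j : Fin (k + 1)) → Fin (msize (i j)),
              ∏ j : Fin (k + 1), (Z ^ e j) ⟨i j, a j⟩ ⟨i (j + 1), a (j + 1)⟩) *
          ((List.ofFn fun j : Fin (k + 1) =>
              (FreeAlgebra.ι ℚ (i j)) ^ fexp j.castSucc).prod *
            (FreeAlgebra.ι ℚ (i 0)) ^ fexp (Fin.last (k + 1))) := by
  have hX : ∀ N : ℕ, Xblk msize ^ N =
      Matrix.diagonal fun p : BlkIdx msize => (FreeAlgebra.ι ℚ p.1) ^ N := by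
    intro N
    rw [Xblk, Matrix.diagonal_pow]
    rfl
  have hZ : ∀ N : ℕ,
      (mapQ Z : Matrix (BlkIdx msize) (BlkIdx msize) (FreeAlgebra ℚ (Fin n))) ^ N =
      (Z ^ N).map (algebraMap ℚ (FreeAlgebra ℚ (Fin n))) := by
    intro N
    exact (map_pow (algebraMap ℚ (FreeAlgebra ℚ (Fin n))).mapMatrix Z N).symm
  simp only [hX, hZ]
  simp only [map_sum, Finset.sum_mul]
  rw [← Fintype.sum_sigma' (fun (i : Fin (k + 1) → Fin n)
    (a : (j : Fin (k + 1)) → Fin (msize (i j))) => _)]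
  refine Eq.trans ?_ (Fintype.sum_equiv (piSigEquiv (J := Fin (k + 1)) (fun i : Fin n => Fin (msize i))) _
    (fun c : Fin (k + 1) → BlkIdx msize =>
      algebraMap ℚ (FreeAlgebra ℚ (Fin n)) (∏ j, (Z ^ e j) (c j) (c (j + 1))) *
      ((List.ofFn fun j : Fin (k + 1) =>
              (FreeAlgebra.ι ℚ (c j).1) ^ fexp j.castSucc).prod *
            (FreeAlgebra.ι ℚ (c 0).1) ^ fexp (Fin.last (k + 1)))) (fun _ => rfl)).symm
  rw [← (Fin.consEquiv (fun _ : Fin (k + 1) => BlkIdx msize)).sum_comp, Fintype.sum_prod_type,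
    Matrix.trace]
  refine Finset.sum_congr rfl fun p _ => ?_
  rw [Matrix.diag_apply, Matrix.diagonal_mul,
    path_expand k (fun j => Z ^ e j) (fun j p => (FreeAlgebra.ι ℚ p.1) ^ fexp j.succ) p p,
    Finset.mul_sum]
  refine Finset.sum_congr rfl fun r _ => ?_
  simp only [Fin.consEquiv, Equiv.coe_fn_mk]
  rw [List.ofFn_succ' (f := fun j : Fin (k + 1) => _ ^ _), List.ofFn_succ (f := fun j : Fin (k + 1) => (FreeAlgebra.ι ℚ (Fin.cons (α := fun _ => BlkIdx msize) p r j).1) ^ fexp j.castSucc)]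
  rw [← mul_assoc, ← Algebra.commutes, mul_assoc]
  simp only [snoc_cyc, List.concat_eq_append, List.prod_append, List.prod_cons, List.prod_nil,
    mul_one, Fin.coeSucc_eq_succ, Fin.cons_succ, Fin.cons_zero, Fin.last_add_one,
    Fin.succ_last, Fin.succ_castSucc, Fin.castSucc_zero, mul_assoc]
end

section
/- Let S = [[0,1],[−1,0]], M = [[0,1],[0,0]], and let A be the 6×6 integer matrix with 2×2 blocks [[M, −S, −S],[S, M, −S],[S, S, M]]; A is a Seifert matrix of type (2,2,2). Then the element tr((X·Z_A)^3·X) of F_3 is not fixed by the reversal anti-automorphism of F_3; specifically, writing elements of F_3 in the monomial (word) basis, the coefficient of the word x_1 x_2 x_3 x_1 in tr((X·Z_A)^3·X) equals 2, while the coefficient of the word x_1 x_3 x_2 x_1 equals −2. -/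
open Matrix

/-- The 6×6 integer matrix with 2×2 blocks `[[M, −S, −S], [S, M, −S], [S, S, M]]`,
where `S = [[0,1],[−1,0]]` and `M = [[0,1],[0,0]]`. -/
def Aexample : Matrix (BlkIdx fun _ : Fin 3 => 2) (BlkIdx fun _ : Fin 3 => 2) ℤ :=
  Matrix.of fun p q =>
    (if p.1 = q.1 then !![0, 1; 0, 0]
      else if p.1 < q.1 then -(!![0, 1; -1, 0]) else !![0, 1; -1, 0]) p.2 q.2


abbrev Bx : Type := BlkIdx fun _ : Fin 3 => 2

/-- The inverse of `A - Aᵀ`. -/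
def Bex : Matrix Bx Bx ℤ :=
  Matrix.of fun p q => (if p.1 = q.1 then !![0, -1; 1, 0] else 0) p.2 q.2

/-- The integer matrix `Z_A`. -/
def Zex : Matrix Bx Bx ℤ :=
  Matrix.of fun p q =>
    (if p.1 = q.1 then !![1, 0; 0, 0]
      else if p.1 < q.1 then !![-1, 0; 0, -1] else !![1, 0; 0, 1]) p.2 q.2

lemma Bex_inv : (Aexample - Aexampleᵀ) * Bex = 1 := by
  decide +kernel

lemma Aex_mul : Aexample * Bex = Zex := by
  decide +kernel

lemma Zof_ex : Zof (Aexample.map ((↑) : ℤ → ℚ)) = Zex.map ((↑) : ℤ → ℚ) := by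
  have h1 : (Aexample.map ((↑) : ℤ → ℚ) - (Aexample.map ((↑) : ℤ → ℚ))ᵀ) *
      Bex.map ((↑) : ℤ → ℚ) = 1 := by
    have := congrArg (fun M : Matrix Bx Bx ℤ => (Int.castRingHom ℚ).mapMatrix M) Bex_inv
    simp only [map_mul, map_sub, map_one] at this
    exact this
  have h2 : Aexample.map ((↑) : ℤ → ℚ) * Bex.map ((↑) : ℤ → ℚ) = Zex.map ((↑) : ℤ → ℚ) := by
    have := congrArg (fun M : Matrix Bx Bx ℤ => (Int.castRingHom ℚ).mapMatrix M) Aex_mul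
    simp only [map_mul] at this
    exact this
  rw [Zof, Matrix.inv_eq_right_inv h1, h2]

noncomputable abbrev g (i : Fin 3) : FreeAlgebra ℚ (Fin 3) := FreeAlgebra.ι ℚ i

lemma trace_eq :
    ((Xblk (fun _ : Fin 3 => 2) *
          mapQ (Zof (Aexample.map ((↑) : ℤ → ℚ)))) ^ 3 *
          Xblk (fun _ : Fin 3 => 2)).trace =
    ∑ p : Bx, ∑ r : Bx, ∑ q : Bx, ((Zex p q * Zex q r * Zex r p : ℤ) : ℚ) •
      (g p.1 * g q.1 * g r.1 * g p.1) := by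
  rw [Zof_ex, pow_succ, pow_two, Matrix.trace]
  refine Finset.sum_congr rfl fun p _ => ?_
  simp only [Matrix.diag_apply, Xblk, Matrix.mul_diagonal]
  rw [Matrix.mul_apply, Finset.sum_mul]
  refine Finset.sum_congr rfl fun r _ => ?_
  rw [Matrix.mul_apply, Finset.sum_mul, Finset.sum_mul]
  refine Finset.sum_congr rfl fun q _ => ?_
  simp only [Matrix.diagonal_mul, mapQ, Matrix.map_apply, Algebra.algebraMap_eq_smul_one,
    mul_smul_comm, smul_mul_assoc, smul_smul, mul_one, mul_assoc]
  congr 1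
  push_cast
  ring

lemma mono_eq (a b c d : Fin 3) :
    g a * g b * g c * g d =
      FreeAlgebra.basisFreeMonoid ℚ (Fin 3) (FreeMonoid.ofList [a, b, c, d]) := by
  simp only [FreeAlgebra.basisFreeMonoid, Module.Basis.map_apply, Finsupp.coe_basisSingleOne]
  change _ = FreeAlgebra.equivMonoidAlgebraFreeMonoid.symm (MonoidAlgebra.single _ 1)
  simp [FreeAlgebra.equivMonoidAlgebraFreeMonoid, MonoidAlgebra.lift_single, mul_assoc, g]

lemma coeff_mono (a b c d : Fin 3) (w : List (Fin 3)) :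
    (FreeAlgebra.basisFreeMonoid ℚ (Fin 3)).repr (g a * g b * g c * g d)
      (FreeMonoid.ofList w) = if [a, b, c, d] = w then 1 else 0 := by
  classical
  rw [mono_eq, Module.Basis.repr_self, Finsupp.single_apply]
  simp only [EmbeddingLike.apply_eq_iff_eq]

lemma coeff_tr (w : List (Fin 3)) :
    (FreeAlgebra.basisFreeMonoid ℚ (Fin 3)).repr
        (((Xblk (fun _ : Fin 3 => 2) *
            mapQ (Zof (Aexample.map ((↑) : ℤ → ℚ)))) ^ 3 *
            Xblk (fun _ : Fin 3 => 2)).trace)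
        (FreeMonoid.ofList w) =
    ((∑ p : Bx, ∑ r : Bx, ∑ q : Bx, if [p.1, q.1, r.1, p.1] = w then
      Zex p q * Zex q r * Zex r p else 0 : ℤ) : ℚ) := by
  rw [trace_eq]
  simp only [map_sum, map_smul, Finsupp.finsetSum_apply, Finsupp.smul_apply, coeff_mono]
  push_cast
  simp

lemma coeff_rev (w : List (Fin 3)) :
    (FreeAlgebra.basisFreeMonoid ℚ (Fin 3)).repr
        (rev (((Xblk (fun _ : Fin 3 => 2) *
            mapQ (Zof (Aexample.map ((↑) : ℤ → ℚ)))) ^ 3 *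
            Xblk (fun _ : Fin 3 => 2)).trace))
        (FreeMonoid.ofList w) =
    ((∑ p : Bx, ∑ r : Bx, ∑ q : Bx, if [p.1, r.1, q.1, p.1] = w then
      Zex p q * Zex q r * Zex r p else 0 : ℤ) : ℚ) := by
  have h : ∀ a b c d : Fin 3, (MulOpposite.unop (FreeAlgebra.lift ℚ
      (fun i => MulOpposite.op (FreeAlgebra.ι ℚ i)) (g a * g b * g c * g d))) =
      g d * g c * g b * g a := by
    intro a b c d
    simp [g, mul_assoc]
  rw [trace_eq, rev]
  simp only [map_sum, map_smul, Finset.unop_sum, MulOpposite.unop_smul, h,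
    Finsupp.finsetSum_apply, Finsupp.smul_apply, coeff_mono]
  push_cast
  simp

lemma c1 : (∑ p : Bx, ∑ r : Bx, ∑ q : Bx, if [p.1, q.1, r.1, p.1] = [0, 1, 2, 0] then
      Zex p q * Zex q r * Zex r p else 0 : ℤ) = 2 := by
  decide +kernel

lemma c2 : (∑ p : Bx, ∑ r : Bx, ∑ q : Bx, if [p.1, q.1, r.1, p.1] = [0, 2, 1, 0] then
      Zex p q * Zex q r * Zex r p else 0 : ℤ) = -2 := by
  decide +kernel

lemma c3 : (∑ p : Bx, ∑ r : Bx, ∑ q : Bx, if [p.1, r.1, q.1, p.1] = [0, 1, 2, 0] then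
      Zex p q * Zex q r * Zex r p else 0 : ℤ) = -2 := by
  decide +kernel

/-- `Aexample` is a Seifert matrix of type (2,2,2), and
`tr ((X·Z_A)³·X)` is not fixed by reversal; specifically its coefficients at the words
`x₁x₂x₃x₁` and `x₁x₃x₂x₁` are `2` and `−2` respectively. -/
theorem stmt17 :
    IsSeifert (fun _ : Fin 3 => 2) Aexample ∧
    rev (((Xblk (fun _ : Fin 3 => 2) *
          mapQ (Zof (Aexample.map ((↑) : ℤ → ℚ)))) ^ 3 *
          Xblk (fun _ : Fin 3 => 2)).trace) ≠
      ((Xblk (fun _ : Fin 3 => 2) *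
          mapQ (Zof (Aexample.map ((↑) : ℤ → ℚ)))) ^ 3 *
          Xblk (fun _ : Fin 3 => 2)).trace ∧
    (FreeAlgebra.basisFreeMonoid ℚ (Fin 3)).repr
        (((Xblk (fun _ : Fin 3 => 2) *
            mapQ (Zof (Aexample.map ((↑) : ℤ → ℚ)))) ^ 3 *
            Xblk (fun _ : Fin 3 => 2)).trace)
        (FreeMonoid.ofList [0, 1, 2, 0]) = 2 ∧
    (FreeAlgebra.basisFreeMonoid ℚ (Fin 3)).repr
        (((Xblk (fun _ : Fin 3 => 2) *
            mapQ (Zof (Aexample.map ((↑) : ℤ → ℚ)))) ^ 3 *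
            Xblk (fun _ : Fin 3 => 2)).trace)
        (FreeMonoid.ofList [0, 2, 1, 0]) = -2 := by
  refine ⟨⟨by decide +kernel, ?_⟩, ?_, ?_, ?_⟩
  · intro i
    rw [Matrix.det_fin_two]
    revert i
    decide +kernel
  · intro h
    have h3 := coeff_rev [0, 1, 2, 0]
    rw [h, coeff_tr, c1, c3] at h3
    norm_num at h3
  · rw [coeff_tr, c1]
    norm_num
  · rw [coeff_tr, c2]
    norm_num
end
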